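/- arXiv:1310.3388 — 2 statements merged into one kernel-verified Lean document; each statement's English description precedes it below -/
import Mathlib

section
/- Let c ∈ ℝ², r > 0, and let (c_i, r_i), i ∈ F, be a finite nonempty family with r_i > r and c_i.y > c.y for every i ∈ F, each pair (c, c_i) in general position. For each i set S_i = {θ ∈ [−π/3, π/3] : γ_{c,r}(θ) ∉ T(c_i,r_i)}. Then ⋂_{i∈F} LC(S_i) = LC(⋂_{i∈F} S_i): the intersection of the lowest connected components of the individual complements equals the lowest connected component of the complement of the union ⋃_{i∈F} T(c_i,r_i) within the right arc A(c,r). -/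
open Real

/-- The Euclidean norm of a point of the plane `ℝ × ℝ`. -/
noncomputable def ptNorm (p : ℝ × ℝ) : ℝ := Real.sqrt (p.1 ^ 2 + p.2 ^ 2)

/-- The parametrization of the right arc: `γ c r θ = c + r·(cos θ, sin θ)`. -/
noncomputable def gam (c : ℝ × ℝ) (r θ : ℝ) : ℝ × ℝ :=
  (c.1 + r * Real.cos θ, c.2 + r * Real.sin θ)

/-- The right portion `T(c,r)`: the closed circular sector
`{c + ρ·(cos θ, sin θ) : 0 ≤ ρ ≤ r, −π/3 ≤ θ ≤ π/3}`. -/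
def Sector (c : ℝ × ℝ) (r : ℝ) : Set (ℝ × ℝ) :=
  {p | ∃ ρ θ : ℝ, 0 ≤ ρ ∧ ρ ≤ r ∧ -(π / 3) ≤ θ ∧ θ ≤ π / 3 ∧
    p = (c.1 + ρ * Real.cos θ, c.2 + ρ * Real.sin θ)}

/-- The right arc `A(c,r)`: the image of `γ c r` on `[−π/3, π/3]`. -/
def Arc (c : ℝ × ℝ) (r : ℝ) : Set (ℝ × ℝ) :=
  {p | ∃ θ : ℝ, -(π / 3) ≤ θ ∧ θ ≤ π / 3 ∧ p = gam c r θ}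

/-- General position of two centers: `c' − c` is not a scalar multiple of
`(cos(π/3), sin(π/3))` nor of `(cos(π/3), −sin(π/3))`. -/
def GenPos (c c' : ℝ × ℝ) : Prop :=
  (∀ t : ℝ, c' - c ≠ t • ((Real.cos (π / 3), Real.sin (π / 3)) : ℝ × ℝ)) ∧
  (∀ t : ℝ, c' - c ≠ t • ((Real.cos (π / 3), -Real.sin (π / 3)) : ℝ × ℝ))

/-- The lowest connected component of `X ⊆ [−π/3, π/3]`: those `θ ∈ X` such that for
all `θ₁ < θ₂ ≤ θ` in `[−π/3, π/3]`, `θ₂ ∉ X → θ₁ ∉ X`. -/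
def LC (X : Set ℝ) : Set ℝ :=
  {θ | θ ∈ X ∧ ∀ θ₁ θ₂ : ℝ, θ₁ ∈ Set.Icc (-(π / 3)) (π / 3) →
    θ₂ ∈ Set.Icc (-(π / 3)) (π / 3) → θ₁ < θ₂ → θ₂ ≤ θ → θ₂ ∉ X → θ₁ ∉ X}

/-- The highest connected component of `X ⊆ [−π/3, π/3]`: those `θ ∈ X` such that for
all `θ ≤ θ₂ < θ₁` in `[−π/3, π/3]`, `θ₂ ∉ X → θ₁ ∉ X`. -/
def HC (X : Set ℝ) : Set ℝ :=
  {θ | θ ∈ X ∧ ∀ θ₁ θ₂ : ℝ, θ₁ ∈ Set.Icc (-(π / 3)) (π / 3) →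
    θ₂ ∈ Set.Icc (-(π / 3)) (π / 3) → θ ≤ θ₂ → θ₂ < θ₁ → θ₂ ∉ X → θ₁ ∉ X}

lemma aux_trig {t : ℝ} (h1 : -(π / 3) ≤ t) (h2 : t ≤ π / 3) :
    1 / 2 ≤ Real.cos t ∧ |Real.sin t| ≤ Real.sqrt 3 / 2 := by
  have hp := Real.pi_pos
  constructor
  · rw [← Real.cos_pi_div_three, ← Real.cos_abs t]
    exact Real.cos_le_cos_of_nonneg_of_le_pi (abs_nonneg t) (by linarith) (abs_le.2 ⟨h1, h2⟩)
  · rw [← Real.sin_pi_div_three, abs_le, ← Real.sin_neg]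
    exact ⟨Real.sin_le_sin_of_le_of_le_pi_div_two (by linarith) (by linarith) h1,
      Real.sin_le_sin_of_le_of_le_pi_div_two (by linarith) (by linarith) h2⟩

lemma aux_wedge {t : ℝ} (h1 : -(π / 3) ≤ t) (h2 : t ≤ π / 3) :
    |Real.sin t| ≤ Real.sqrt 3 * Real.cos t := by
  obtain ⟨h, h'⟩ := aux_trig h1 h2
  have := Real.sqrt_nonneg 3
  nlinarith

lemma mem_Sector_iff (c p : ℝ × ℝ) (r : ℝ) (hr : 0 ≤ r) :
    p ∈ Sector c r ↔ (p.1 - c.1) ^ 2 + (p.2 - c.2) ^ 2 ≤ r ^ 2 ∧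
      |p.2 - c.2| ≤ Real.sqrt 3 * (p.1 - c.1) := by
  constructor
  · rintro ⟨ρ, θ, h0, hρ, h1, h2, rfl⟩
    have hw := aux_wedge h1 h2
    have hcs := Real.sin_sq_add_cos_sq θ
    constructor
    · have : (c.1 + ρ * Real.cos θ - c.1) ^ 2 + (c.2 + ρ * Real.sin θ - c.2) ^ 2 = ρ ^ 2 := by
        linear_combination ρ ^ 2 * hcs
      simp only [this]
      gcongr
    · simp only [add_sub_cancel_left, abs_mul, abs_of_nonneg h0]
      nlinarith [mul_le_mul_of_nonneg_left hw h0]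
  · rintro ⟨hd, hw⟩
    obtain ⟨c1, c2⟩ := c
    obtain ⟨p1, p2⟩ := p
    simp only at hd hw
    have hs : 0 < Real.sqrt 3 := by positivity
    have hu : 0 ≤ p1 - c1 := by
      by_contra h
      push Not at h
      nlinarith [abs_nonneg (p2 - c2), mul_neg_of_pos_of_neg hs h]
    have hpi := Real.pi_pos
    rcases hu.eq_or_lt with hu | hu
    · rw [← hu, mul_zero] at hw
      have h2 : p2 - c2 = 0 := abs_eq_zero.1 (le_antisymm hw (abs_nonneg _))
      refine ⟨0, 0, le_rfl, hr, by linarith, by linarith, ?_⟩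
      ext <;> simp <;> linarith
    · have hne : p1 - c1 ≠ 0 := hu.ne'
      set x := (p2 - c2) / (p1 - c1) with hx
      have hxv : (p1 - c1) * x = p2 - c2 := by rw [hx]; field_simp
      have hax : |x| ≤ Real.sqrt 3 := by
        rw [hx, abs_div, abs_of_pos hu, div_le_iff₀ hu]; exact hw
      have hq : 0 < 1 + x ^ 2 := by positivity
      have hq' : 0 < Real.sqrt (1 + x ^ 2) := Real.sqrt_pos.2 hq
      have hat : Real.arctan (Real.sqrt 3) = π / 3 := by
        rw [← Real.tan_pi_div_three]
        exact Real.arctan_tan (by linarith) (by linarith)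
      refine ⟨(p1 - c1) * Real.sqrt (1 + x ^ 2), Real.arctan x, by positivity, ?_, ?_, ?_, ?_⟩
      · refine (sq_le_sq₀ (by positivity) hr).1 ?_
        rw [mul_pow, Real.sq_sqrt hq.le]
        have : (p1 - c1) ^ 2 * (1 + x ^ 2) = (p1 - c1) ^ 2 + (p2 - c2) ^ 2 := by
          rw [← hxv]; ring
        linarith
      · rw [← hat, ← Real.arctan_neg]
        exact Real.arctan_strictMono.monotone (abs_le.1 hax).1
      · rw [← hat]
        exact Real.arctan_strictMono.monotone (abs_le.1 hax).2
      · rw [Real.cos_arctan, Real.sin_arctan]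
        ext
        · simp only; field_simp; ring
        · simp only
          have : (p1 - c1) * √(1 + x ^ 2) * (x / √(1 + x ^ 2)) = (p1 - c1) * x := by
            field_simp
          rw [this, hxv]; ring

/-- Membership of an arc point in a sector, with `a = c'.1 - c.1`, `h = c'.2 - c.2`. -/
lemma gam_mem_iff (c c' : ℝ × ℝ) (r r' t : ℝ) (hr' : 0 ≤ r') :
    gam c r t ∈ Sector c' r' ↔
      r ^ 2 + (c'.1 - c.1) ^ 2 + (c'.2 - c.2) ^ 2
        - 2 * r * ((c'.1 - c.1) * Real.cos t + (c'.2 - c.2) * Real.sin t) ≤ r' ^ 2 ∧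
      |r * Real.sin t - (c'.2 - c.2)| ≤ Real.sqrt 3 * (r * Real.cos t - (c'.1 - c.1)) := by
  rw [mem_Sector_iff _ _ _ hr']
  simp only [gam]
  have hcs := Real.sin_sq_add_cos_sq t
  have e1 : (c.1 + r * Real.cos t - c'.1) ^ 2 + (c.2 + r * Real.sin t - c'.2) ^ 2 =
      r ^ 2 + (c'.1 - c.1) ^ 2 + (c'.2 - c.2) ^ 2
        - 2 * r * ((c'.1 - c.1) * Real.cos t + (c'.2 - c.2) * Real.sin t) := by
    linear_combination r ^ 2 * hcs
  have e2 : c.2 + r * Real.sin t - c'.2 = r * Real.sin t - (c'.2 - c.2) := by ring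
  have e3 : c.1 + r * Real.cos t - c'.1 = r * Real.cos t - (c'.1 - c.1) := by ring
  rw [e1, e2, e3]

lemma diff_formula (a h s t : ℝ) :
    (a * Real.cos t + h * Real.sin t) - (a * Real.cos s + h * Real.sin s) =
      2 * Real.sin ((t - s) / 2) *
        (h * Real.cos ((t + s) / 2) - a * Real.sin ((t + s) / 2)) := by
  have h1 := Real.cos_sub_cos t s
  have h2 := Real.sin_sub_sin t s
  linear_combination a * h1 + h * h2

lemma sin_half_pos {s t : ℝ} (h : s < t) (hs : -(π / 3) ≤ s) (ht : t ≤ π / 3) :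
    0 < Real.sin ((t - s) / 2) :=
  Real.sin_pos_of_pos_of_lt_pi (by linarith) (by linarith [Real.pi_pos])

lemma u_lt_iff {a h s t : ℝ} (hst : s < t) (hs : -(π / 3) ≤ s) (ht : t ≤ π / 3) :
    a * Real.cos s + h * Real.sin s < a * Real.cos t + h * Real.sin t ↔
      0 < h * Real.cos ((t + s) / 2) - a * Real.sin ((t + s) / 2) := by
  have hp : 0 < 2 * Real.sin ((t - s) / 2) := by linarith [sin_half_pos hst hs ht]
  rw [← sub_pos, diff_formula, mul_pos_iff_of_pos_left hp]

lemma u_le_iff {a h s t : ℝ} (hst : s < t) (hs : -(π / 3) ≤ s) (ht : t ≤ π / 3) :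
    a * Real.cos s + h * Real.sin s ≤ a * Real.cos t + h * Real.sin t ↔
      0 ≤ h * Real.cos ((t + s) / 2) - a * Real.sin ((t + s) / 2) := by
  have hp : 0 < 2 * Real.sin ((t - s) / 2) := by linarith [sin_half_pos hst hs ht]
  rw [← sub_nonneg, diff_formula, mul_nonneg_iff_of_pos_left hp]

lemma g_mono {a h m n : ℝ} (ha : a ≤ 0) (hh : 0 ≤ h) (hm : -(π / 3) ≤ m) (hmn : m ≤ n)
    (hn : n ≤ 0) :
    h * Real.cos m - a * Real.sin m ≤ h * Real.cos n - a * Real.sin n := by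
  have hp := Real.pi_pos
  have h1 : Real.cos m ≤ Real.cos n := by
    rw [← Real.cos_neg m, ← Real.cos_neg n]
    exact Real.cos_le_cos_of_nonneg_of_le_pi (by linarith) (by linarith) (by linarith)
  have h2 : Real.sin m ≤ Real.sin n :=
    Real.sin_le_sin_of_le_of_le_pi_div_two (by linarith) (by linarith) hmn
  nlinarith

lemma sin_neg_third : Real.sin (-(π / 3)) = -(Real.sqrt 3 / 2) := by
  rw [Real.sin_neg, Real.sin_pi_div_three]

lemma cos_neg_third : Real.cos (-(π / 3)) = 1 / 2 := by
  rw [Real.cos_neg, Real.cos_pi_div_three]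

/-- If the lowest point of the arc is not in the sector, then the sector with each
parameter `x < 0` contains all of `[x, -x]`. -/
lemma lemmaA (c c' : ℝ × ℝ) (r r' : ℝ) (hr : 0 < r) (hr' : r < r') (hy : c.2 < c'.2)
    (hb : gam c r (-(π / 3)) ∉ Sector c' r') {x t : ℝ} (hx1 : -(π / 3) ≤ x) (hx0 : x < 0)
    (hx : gam c r x ∈ Sector c' r') (h1 : x ≤ t) (h2 : t ≤ -x) :
    gam c r t ∈ Sector c' r' := by
  have hpi := Real.pi_pos
  rw [gam_mem_iff _ _ _ _ _ (by linarith)] at hb hx ⊢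
  set a := c'.1 - c.1
  set h := c'.2 - c.2 with hhd
  have hh : 0 < h := by rw [hhd]; linarith
  obtain ⟨hd, hw⟩ := hx
  have hs3 : 0 < Real.sqrt 3 := by positivity
  have hs33 : Real.sqrt 3 ^ 2 = 3 := Real.sq_sqrt (by norm_num)
  have hct : Real.cos x ≤ Real.cos t := by
    rw [← Real.cos_abs x, ← Real.cos_abs t, abs_of_neg hx0]
    exact Real.cos_le_cos_of_nonneg_of_le_pi (abs_nonneg t) (by linarith)
      (abs_le.2 ⟨by linarith, h2⟩)
  have hst : Real.sin x ≤ Real.sin t :=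
    Real.sin_le_sin_of_le_of_le_pi_div_two (by linarith) (by linarith) h1
  have hst' : Real.sin t ≤ - Real.sin x := by
    rw [← Real.sin_neg]
    exact Real.sin_le_sin_of_le_of_le_pi_div_two (by linarith) (by linarith) h2
  refine ⟨?_, ?_⟩
  · suffices hu : a * Real.cos x + h * Real.sin x ≤ a * Real.cos t + h * Real.sin t by
      linarith [mul_le_mul_of_nonneg_left hu (by linarith : 0 ≤ 2 * r)]
    rcases le_or_gt 0 a with ha | ha
    · linarith [mul_le_mul_of_nonneg_left hct ha, mul_le_mul_of_nonneg_left hst hh.le]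
    · rcases h1.eq_or_lt with rfl | h1
      · exact le_rfl
      rw [u_le_iff h1 hx1 (by linarith)]
      by_cases hc : h ≤ Real.sqrt 3 * (-a)
      · have hbw : |r * Real.sin (-(π / 3)) - h| ≤
            Real.sqrt 3 * (r * Real.cos (-(π / 3)) - a) := by
          rw [sin_neg_third, cos_neg_third, abs_le]
          have := mul_pos hr hs3
          constructor <;> linarith
        have hbd : r' ^ 2 < r ^ 2 + a ^ 2 + h ^ 2
            - 2 * r * (a * Real.cos (-(π / 3)) + h * Real.sin (-(π / 3))) := by
          by_contra hcon
          exact hb ⟨not_lt.1 hcon, hbw⟩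
        have hlt : a * Real.cos (-(π / 3)) + h * Real.sin (-(π / 3)) <
            a * Real.cos x + h * Real.sin x := by
          by_contra hcon
          push Not at hcon
          linarith [mul_le_mul_of_nonneg_left hcon (by linarith : 0 ≤ 2 * r)]
        have hxb : -(π / 3) < x := by
          rcases hx1.eq_or_lt with hh1 | hh1
          · rw [hh1] at hlt; exact absurd hlt (lt_irrefl _)
          · exact hh1
        rw [u_lt_iff hxb le_rfl (by linarith)] at hlt
        have hgm := g_mono (a := a) (h := h) (m := (x + -(π / 3)) / 2) (n := (t + x) / 2) ha.le hh.le
          (by linarith) (by linarith) (by linarith)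
        linarith
      · push Not at hc
        obtain ⟨k1, k2⟩ := aux_trig (t := (t + x) / 2) (by linarith) (by linarith)
        have k3 := (abs_le.1 k2).1
        linarith [mul_le_mul_of_nonneg_left k3 (neg_nonneg.2 ha.le),
          mul_le_mul_of_nonneg_left k1 hh.le]
  · have hw1 := (abs_le.1 hw).1
    rw [abs_le]
    have e1 := mul_le_mul_of_nonneg_left hct (mul_pos hs3 hr).le
    have e2 := mul_le_mul_of_nonneg_left hst hr.le
    have e3 := mul_le_mul_of_nonneg_left hst' hr.le
    constructor <;> linarith

/-- If the lowest point of the arc is in the sector, the complement is one interval. -/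
lemma lemmaB (c c' : ℝ × ℝ) (r r' : ℝ) (hr : 0 < r) (hr' : r < r') (hy : c.2 < c'.2)
    (hb : gam c r (-(π / 3)) ∈ Sector c' r') {x y : ℝ} (hx1 : -(π / 3) ≤ x)
    (hx : gam c r x ∈ Sector c' r') (hxy : x < y) (hy2 : y ≤ π / 3)
    (hyn : gam c r y ∉ Sector c' r') :
    x + y < 0 ∧ ∀ z, -(π / 3) ≤ z → z ≤ x → gam c r z ∈ Sector c' r' := by
  have hpi := Real.pi_pos
  have hr0 : 0 ≤ r' := by linarith
  rw [gam_mem_iff _ _ _ _ _ hr0] at hb hx hyn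
  simp only [gam_mem_iff _ _ _ _ _ hr0]
  set a := c'.1 - c.1
  set h := c'.2 - c.2 with hhd
  have hh : 0 < h := by rw [hhd]; linarith
  have hs3 : 0 < Real.sqrt 3 := by positivity
  have hah : h ≤ Real.sqrt 3 * (-a) := by
    have := (abs_le.1 hb.2).1
    rw [sin_neg_third, cos_neg_third] at this
    linarith
  have ha : a ≤ 0 := by
    by_contra hcon
    push Not at hcon
    linarith [mul_pos hs3 hcon]
  have hwedge : ∀ z, -(π / 3) ≤ z → z ≤ π / 3 →
      |r * Real.sin z - h| ≤ Real.sqrt 3 * (r * Real.cos z - a) := by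
    intro z hz1 hz2
    obtain ⟨k1, k2⟩ := abs_le.1 (aux_wedge hz1 hz2)
    have k1' := mul_le_mul_of_nonneg_left k1 hr.le
    have k2' := mul_le_mul_of_nonneg_left k2 hr.le
    rw [abs_le]
    constructor <;> linarith
  have hyd : r' ^ 2 < r ^ 2 + a ^ 2 + h ^ 2
      - 2 * r * (a * Real.cos y + h * Real.sin y) := by
    by_contra hcon
    exact hyn ⟨not_lt.1 hcon, hwedge y (by linarith) hy2⟩
  have hlt : a * Real.cos y + h * Real.sin y < a * Real.cos x + h * Real.sin x := by
    by_contra hcon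
    push Not at hcon
    linarith [mul_le_mul_of_nonneg_left hcon (by linarith : 0 ≤ 2 * r), hx.1]
  have hg : h * Real.cos ((y + x) / 2) - a * Real.sin ((y + x) / 2) < 0 := by
    rw [← not_le, ← u_le_iff hxy hx1 hy2]
    exact not_le.2 hlt
  have hneg : x + y < 0 := by
    by_contra hcon
    push Not at hcon
    have k1 := (aux_trig (t := (y + x) / 2) (by linarith) (by linarith)).1
    have k2 : 0 ≤ Real.sin ((y + x) / 2) :=
      Real.sin_nonneg_of_nonneg_of_le_pi (by linarith) (by linarith)
    linarith [mul_nonneg (neg_nonneg.2 ha) k2, mul_le_mul_of_nonneg_left k1 hh.le]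
  refine ⟨hneg, fun z hz1 hz2 => ⟨?_, hwedge z hz1 (by linarith)⟩⟩
  rcases hz2.eq_or_lt with rfl | hz2
  · exact hx.1
  have hgm := g_mono (a := a) (h := h) (m := (x + z) / 2) (n := (y + x) / 2) ha hh.le
    (by linarith) (by linarith) (by linarith)
  have : a * Real.cos x + h * Real.sin x ≤ a * Real.cos z + h * Real.sin z := by
    rw [← not_lt, u_lt_iff hz2 hz1 (by linarith)]
    linarith
  linarith [mul_le_mul_of_nonneg_left this (by linarith : 0 ≤ 2 * r), hx.1]

lemma closed_C (c c' : ℝ × ℝ) (r r' : ℝ) (hr' : 0 ≤ r') :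
    IsClosed {t : ℝ | gam c r t ∈ Sector c' r'} := by
  simp only [gam_mem_iff _ _ _ _ _ hr', Set.ofPred_and]
  apply IsClosed.inter
  · exact isClosed_le (by fun_prop) (by fun_prop)
  · exact isClosed_le (by fun_prop) (by fun_prop)

/-- For a finite nonempty family of larger disks whose centers all lie
above `c`, the intersection of the lowest connected components of the individual sets
`S_i = {θ ∈ [−π/3, π/3] : γ_{c,r}(θ) ∉ T(c_i,r_i)}` equals the lowest connected
component of the complement of the union within the right arc. -/
theorem inter_LC_eq_LC_inter {ι : Type*} (F : Finset ι) (hF : F.Nonempty)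
    (c : ℝ × ℝ) (r : ℝ) (hr : 0 < r)
    (ci : ι → ℝ × ℝ) (ri : ι → ℝ)
    (hri : ∀ i ∈ F, r < ri i) (hyi : ∀ i ∈ F, c.2 < (ci i).2)
    (hgp : ∀ i ∈ F, GenPos c (ci i)) :
    (⋂ i ∈ F, LC {θ : ℝ | θ ∈ Set.Icc (-(π / 3)) (π / 3) ∧
        gam c r θ ∉ Sector (ci i) (ri i)}) =
      LC {θ : ℝ | θ ∈ Set.Icc (-(π / 3)) (π / 3) ∧
        gam c r θ ∉ ⋃ i ∈ F, Sector (ci i) (ri i)} := by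
  have hpi := Real.pi_pos
  ext θ
  simp only [Set.mem_iInter]
  constructor
  · intro H
    obtain ⟨i0, hi0⟩ := hF
    refine ⟨⟨(H i0 hi0).1.1, ?_⟩, ?_⟩
    · simp only [Set.mem_iUnion, not_exists]
      intro i hi
      exact (H i hi).1.2
    · intro θ₁ θ₂ h1 h2 h12 h2θ hn hm
      apply hn
      refine ⟨h2, ?_⟩
      simp only [Set.mem_iUnion, not_exists]
      intro i hi hmem
      refine (H i hi).2 θ₁ θ₂ h1 h2 h12 h2θ (fun hc => hc.2 hmem) ⟨h1, fun hc => hm.2 ?_⟩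
      simp only [Set.mem_iUnion]
      exact ⟨i, hi, hc⟩
  · rintro ⟨⟨hθ, hθn⟩, H⟩ i hi
    simp only [Set.mem_iUnion, not_exists] at hθn
    refine ⟨⟨hθ, hθn i hi⟩, ?_⟩
    intro θ₁ θ₂ h1 h2 h12 h2θ hn hm
    have h2i : gam c r θ₂ ∈ Sector (ci i) (ri i) := by
      by_contra hc
      exact hn ⟨h2, hc⟩
    have hθ2 : θ₂ < θ := by
      rcases h2θ.eq_or_lt with hh | hh
      · rw [hh] at h2i
        exact absurd h2i (hθn i hi)
      · exact hh
    have hcov : ∀ x, -(π / 3) ≤ x → x < θ₂ → ∃ k ∈ F, gam c r x ∈ Sector (ci k) (ri k) := by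
      intro x hx1 hx2
      have hxI : x ∈ Set.Icc (-(π / 3)) (π / 3) := ⟨hx1, by linarith [h2.2]⟩
      by_contra hc
      push Not at hc
      refine H x θ₂ hxI h2 hx2 h2θ (fun hh => hh.2 ?_) ⟨hxI, ?_⟩
      · simp only [Set.mem_iUnion]
        exact ⟨i, hi, h2i⟩
      · simp only [Set.mem_iUnion, not_exists]
        exact hc
    by_cases hiJ : gam c r (-(π / 3)) ∈ Sector (ci i) (ri i)
    · exact hm.2 ((lemmaB c (ci i) r (ri i) hr (hri i hi) (hyi i hi) hiJ h2.1 h2i hθ2 hθ.2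
        (hθn i hi)).2 θ₁ h1.1 h12.le)
    obtain ⟨j0, hj0, hj0b⟩ := hcov (-(π / 3)) le_rfl (lt_of_le_of_lt h1.1 h12)
    set A : Set ℝ := Set.Icc (-(π / 3)) θ₂ ∩
      ⋃ j ∈ {j | j ∈ F ∧ gam c r (-(π / 3)) ∈ Sector (ci j) (ri j)},
        {t : ℝ | gam c r t ∈ Sector (ci j) (ri j)} with hA
    have hAc : IsCompact A := by
      apply isCompact_Icc.inter_right
      apply Set.Finite.isClosed_biUnion
      · exact F.finite_toSet.subset (fun j hj => hj.1)
      · intro j hj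
        exact closed_C _ _ _ _ (by linarith [hri j hj.1])
    have hAne : A.Nonempty := by
      refine ⟨-(π / 3), ⟨le_rfl, by linarith [h2.1]⟩, ?_⟩
      simp only [Set.mem_iUnion]
      exact ⟨j0, ⟨hj0, hj0b⟩, hj0b⟩
    obtain ⟨xs, hxs, hmax⟩ := hAc.exists_isGreatest hAne
    obtain ⟨hxsI, hxsU⟩ := hxs
    simp only [Set.mem_iUnion] at hxsU
    obtain ⟨j, ⟨hj, hjb⟩, hxj⟩ := hxsU
    have hsum := (lemmaB c (ci j) r (ri j) hr (hri j hj) (hyi j hj) hjb hxsI.1 hxj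
      (lt_of_le_of_lt hxsI.2 hθ2) hθ.2 (hθn j hj)).1
    rcases hxsI.2.eq_or_lt with he | hlt
    · exact hθn i hi (lemmaA c (ci i) r (ri i) hr (hri i hi) (hyi i hi) hiJ h2.1
        (by linarith) h2i h2θ (by linarith))
    · obtain ⟨x, hx1, hx2⟩ := exists_between
        (lt_min hlt (lt_min (by linarith : xs < 0) (by linarith : xs < -θ)))
      obtain ⟨hxa, hxb⟩ := lt_min_iff.1 hx2
      obtain ⟨hxb, hxc⟩ := lt_min_iff.1 hxb
      have hxl : -(π / 3) ≤ x := by linarith [hxsI.1]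
      obtain ⟨k, hk, hkx⟩ := hcov x hxl hxa
      have hkJ : gam c r (-(π / 3)) ∉ Sector (ci k) (ri k) := by
        intro hkb
        have : x ∈ A := by
          refine ⟨⟨hxl, hxa.le⟩, ?_⟩
          simp only [Set.mem_iUnion]
          exact ⟨k, ⟨hk, hkb⟩, hkx⟩
        linarith [hmax this]
      exact hθn k hk (lemmaA c (ci k) r (ri k) hr (hri k hk) (hyi k hk) hkJ hxl hxb hkx
        (by linarith) (by linarith))
end

section
/- Let c ∈ ℝ², r > 0, and let (c_i, r_i), i ∈ F, be a finite nonempty family with r_i > r and c_i.y > c.y for every i ∈ F, each pair (c, c_i) in general position. For G ⊆ F set S_G = {θ ∈ [−π/3, π/3] : γ_{c,r}(θ) ∉ ⋃_{i∈G} T(c_i,r_i)}. Then for every partition of F into nonempty pairwise disjoint subsets F₁, …, F_s with F = F₁ ∪ … ∪ F_s, one has ⋂_{j=1}^{s} LC(S_{F_j}) = LC(S_F). (Decomposability: the construction of the surviving subarc can be performed separately on any partition of the family of larger disks and the results intersected.) -/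
open Real

/-- For a subfamily `G` of larger disks, the set of angles `θ ∈ [−π/3, π/3]` whose
arc point `γ_{c,r}(θ)` avoids the union of the right portions over `G`. -/
def SG {ι : Type*} (c : ℝ × ℝ) (r : ℝ) (ci : ι → ℝ × ℝ) (ri : ι → ℝ)
    (G : Finset ι) : Set ℝ :=
  {θ | θ ∈ Set.Icc (-(π / 3)) (π / 3) ∧ gam c r θ ∉ ⋃ i ∈ G, Sector (ci i) (ri i)}


/-- Blocked angles. -/
def Blk (c : ℝ × ℝ) (r : ℝ) (d : ℝ × ℝ) (R : ℝ) : Set ℝ := {θ | gam c r θ ∈ Sector d R}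

lemma cos_half {θ : ℝ} (h1 : -(π / 3) ≤ θ) (h2 : θ ≤ π / 3) : 1 / 2 ≤ Real.cos θ := by
  rw [← Real.cos_pi_div_three, ← Real.cos_abs θ]
  apply Real.cos_le_cos_of_nonneg_of_le_pi (abs_nonneg _) (by linarith [Real.pi_pos])
  exact abs_le.2 ⟨h1, h2⟩

lemma sector_iff (c : ℝ × ℝ) (r : ℝ) (hr : 0 < r) (p : ℝ × ℝ) :
    p ∈ Sector c r ↔ |p.2 - c.2| ≤ √3 * (p.1 - c.1) ∧
      (p.1 - c.1) ^ 2 + (p.2 - c.2) ^ 2 ≤ r ^ 2 := by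
  have h3 : √3 ^ 2 = (3 : ℝ) := Real.sq_sqrt (by norm_num)
  have h3p : 0 < √(3 : ℝ) := Real.sqrt_pos.2 (by norm_num)
  constructor
  · rintro ⟨ρ, θ, h0, h1, h2, h4, rfl⟩
    have hc := cos_half h2 h4
    have hs := Real.sin_sq_add_cos_sq θ
    simp only [add_sub_cancel_left]
    constructor
    · apply abs_le_of_sq_le_sq
      · have : 0 ≤ ρ ^ 2 * (3 * Real.cos θ ^ 2 - Real.sin θ ^ 2) := by
          apply mul_nonneg (sq_nonneg _); nlinarith
        have e : (√3 * (ρ * Real.cos θ)) ^ 2 = 3 * (ρ * Real.cos θ) ^ 2 := by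
          rw [mul_pow, h3]
        rw [e]; nlinarith
      · have : 0 ≤ Real.cos θ := by linarith
        positivity
    · have : (ρ * Real.cos θ) ^ 2 + (ρ * Real.sin θ) ^ 2 = ρ ^ 2 := by
        linear_combination ρ ^ 2 * hs
      rw [this]; gcongr
  · rintro ⟨h1, h2⟩
    obtain ⟨px, py⟩ := p
    obtain ⟨cx, cy⟩ := c
    simp only at h1 h2
    obtain ⟨x, rfl⟩ : ∃ x, px = cx + x := ⟨px - cx, by ring⟩
    obtain ⟨y, rfl⟩ : ∃ y, py = cy + y := ⟨py - cy, by ring⟩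
    simp only [add_sub_cancel_left] at h1 h2
    have hx : 0 ≤ x := by
      have := (abs_nonneg y).trans h1
      exact nonneg_of_mul_nonneg_right this h3p
    rcases hx.eq_or_lt with rfl | hx
    · have hy : y = 0 := by simpa using h1
      subst hy
      exact ⟨0, 0, le_rfl, hr.le, by linarith [Real.pi_pos], by linarith [Real.pi_pos], by simp⟩
    · have hb := abs_le.1 h1
      have e3 : Real.arctan (√3) = π / 3 := by
        rw [← Real.tan_pi_div_three]
        exact Real.arctan_tan (by linarith [Real.pi_pos]) (by linarith [Real.pi_pos])
      refine ⟨√(x ^ 2 + y ^ 2), Real.arctan (y / x), Real.sqrt_nonneg _, ?_, ?_, ?_, ?_⟩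
      · exact Real.sqrt_le_iff.2 ⟨hr.le, h2⟩
      · rw [← e3, ← Real.arctan_neg]
        apply Real.arctan_mono
        rw [le_div_iff₀ hx]; linarith
      · rw [← e3]
        apply Real.arctan_mono
        rw [div_le_iff₀ hx]; linarith
      · have e : √(x ^ 2 + y ^ 2) = x * √(1 + (y / x) ^ 2) := by
          rw [Real.sqrt_eq_iff_mul_self_eq (by positivity) (by positivity)]
          have : √(1 + (y / x) ^ 2) * √(1 + (y / x) ^ 2) = 1 + (y / x) ^ 2 :=
            Real.mul_self_sqrt (by positivity)
          symm
          calc _ = x ^ 2 * (√(1 + (y / x) ^ 2) * √(1 + (y / x) ^ 2)) := by ring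
            _ = _ := by rw [this]; field_simp
        have hp : 0 < √(1 + (y / x) ^ 2) := Real.sqrt_pos.2 (by positivity)
        rw [Real.cos_arctan, Real.sin_arctan, e]
        ext
        · simp only; field_simp
        · simp only; field_simp

lemma blk_iff (c : ℝ × ℝ) (r : ℝ) (d : ℝ × ℝ) (R : ℝ) (hR : 0 < R) (θ : ℝ) :
    θ ∈ Blk c r d R ↔ |r * Real.sin θ - (d.2 - c.2)| ≤ √3 * (r * Real.cos θ - (d.1 - c.1)) ∧
      (r * Real.cos θ - (d.1 - c.1)) ^ 2 + (r * Real.sin θ - (d.2 - c.2)) ^ 2 ≤ R ^ 2 := by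
  have := sector_iff d R hR (gam c r θ)
  rw [Blk, Set.mem_ofPred_eq, this]
  simp only [gam]
  rw [show c.1 + r * Real.cos θ - d.1 = r * Real.cos θ - (d.1 - c.1) by ring,
    show c.2 + r * Real.sin θ - d.2 = r * Real.sin θ - (d.2 - c.2) by ring]

lemma blk_closed (c : ℝ × ℝ) (r : ℝ) (d : ℝ × ℝ) (R : ℝ) (hR : 0 < R) :
    IsClosed (Blk c r d R) := by
  have : Blk c r d R = {θ | |r * Real.sin θ - (d.2 - c.2)| ≤
      √3 * (r * Real.cos θ - (d.1 - c.1))} ∩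
      {θ | (r * Real.cos θ - (d.1 - c.1)) ^ 2 + (r * Real.sin θ - (d.2 - c.2)) ^ 2 ≤ R ^ 2} := by
    ext θ; exact blk_iff c r d R hR θ
  rw [this]
  apply IsClosed.inter
  · exact isClosed_le (by fun_prop) (by fun_prop)
  · exact isClosed_le (by fun_prop) (by fun_prop)

lemma blk_refl (c : ℝ × ℝ) (r : ℝ) (hr : 0 < r) (d : ℝ × ℝ) (R : ℝ) (hR : 0 < R)
    (hy : c.2 < d.2) (θ : ℝ) (h0 : 0 ≤ θ) (h1 : θ ≤ π / 3) (h : -θ ∈ Blk c r d R) :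
    θ ∈ Blk c r d R := by
  rw [blk_iff _ _ _ _ hR] at h ⊢
  rw [Real.sin_neg, Real.cos_neg] at h
  have hs : 0 ≤ r * Real.sin θ :=
    mul_nonneg hr.le (Real.sin_nonneg_of_nonneg_of_le_pi h0 (by linarith [Real.pi_pos]))
  have hv : 0 < d.2 - c.2 := by linarith
  have habs : |r * Real.sin θ - (d.2 - c.2)| ≤ |r * -Real.sin θ - (d.2 - c.2)| := by
    apply sq_le_sq.1; nlinarith
  exact ⟨habs.trans h.1, by have := sq_le_sq.2 habs; linarith [h.2]⟩

lemma cos_quasi {a b d β κ : ℝ} (hab : a ≤ b) (hbd : b ≤ d) (ha : -π ≤ a - β) (hd : d - β ≤ π)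
    (h1 : κ ≤ Real.cos (a - β)) (h2 : κ ≤ Real.cos (d - β)) : κ ≤ Real.cos (b - β) := by
  rcases le_total 0 (b - β) with h | h
  · exact h2.trans (Real.cos_le_cos_of_nonneg_of_le_pi h hd (by linarith))
  · rw [← Real.cos_neg (b - β)]
    rw [← Real.cos_neg] at h1
    exact h1.trans (Real.cos_le_cos_of_nonneg_of_le_pi (by linarith) (by linarith) (by linarith))

lemma blk_dich (c : ℝ × ℝ) (r : ℝ) (hr : 0 < r) (d : ℝ × ℝ) (R : ℝ) (hR : 0 < R)
    (hy : c.2 < d.2) :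
    (∀ x y z : ℝ, -(π / 3) ≤ x → x ≤ y → y ≤ z → z ≤ π / 3 → x ∉ Blk c r d R →
      z ∉ Blk c r d R → y ∉ Blk c r d R) ∨
    ((∀ x y z : ℝ, -(π / 3) ≤ x → x ≤ y → y ≤ z → z ≤ π / 3 → x ∈ Blk c r d R →
      z ∈ Blk c r d R → y ∈ Blk c r d R) ∧ -(π / 3) ∉ Blk c r d R) := by
  have hpi := Real.pi_pos
  have h3 : √3 ^ 2 = (3 : ℝ) := Real.sq_sqrt (by norm_num)
  have h3p : 0 < √(3 : ℝ) := Real.sqrt_pos.2 (by norm_num)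
  obtain ⟨A, α, hA, hα0, hα1, hu, hv⟩ : ∃ A α : ℝ, 0 < A ∧ 0 < α ∧ α < π ∧
      d.1 - c.1 = A * Real.cos α ∧ d.2 - c.2 = A * Real.sin α := by
    set w : ℂ := ⟨d.1 - c.1, d.2 - c.2⟩ with hw
    have him : 0 < w.im := by simp [hw]; exact hy
    have hw0 : w ≠ 0 := by intro h; rw [h] at him; simp at him
    have hn : 0 < ‖w‖ := norm_pos_iff.2 hw0
    have e1 : ‖w‖ * Real.sin w.arg = w.im := Complex.norm_mul_sin_arg w
    have e2 : ‖w‖ * Real.cos w.arg = w.re := Complex.norm_mul_cos_arg w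
    have hsin : 0 < Real.sin w.arg := by
      by_contra h
      push Not at h
      have := mul_nonpos_of_nonneg_of_nonpos hn.le h
      linarith
    have harg : 0 ≤ w.arg := Complex.arg_nonneg_iff.2 him.le
    refine ⟨‖w‖, w.arg, hn, ?_, ?_, e2.symm, e1.symm⟩
    · refine lt_of_le_of_ne harg fun h => ?_
      rw [← h] at hsin; simp at hsin
    · refine lt_of_le_of_ne (Complex.arg_le_pi w) fun h => ?_
      rw [h] at hsin; simp at hsin
  have hB : ∀ θ, θ ∈ Blk c r d R ↔
      (√3 * (A * Real.cos α) + A * Real.sin α) / (2 * r) ≤ Real.cos (θ - π / 6) ∧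
      (√3 * (A * Real.cos α) - A * Real.sin α) / (2 * r) ≤ Real.cos (θ - -(π / 6)) ∧
      (r ^ 2 + A ^ 2 - R ^ 2) / (2 * r * A) ≤ Real.cos (θ - α) := by
    intro θ
    rw [blk_iff _ _ _ _ hR, hu, hv, abs_le, div_le_iff₀ (by positivity),
      div_le_iff₀ (by positivity), div_le_iff₀ (by positivity), Real.cos_sub, Real.cos_sub,
      Real.cos_sub, Real.cos_neg, Real.sin_neg, Real.cos_pi_div_six, Real.sin_pi_div_six, and_assoc]
    have t1 := Real.sin_sq_add_cos_sq θ
    have t2 := Real.sin_sq_add_cos_sq α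
    have e : (r * Real.cos θ - A * Real.cos α) ^ 2 + (r * Real.sin θ - A * Real.sin α) ^ 2
      = r ^ 2 + A ^ 2 - (Real.cos θ * Real.cos α + Real.sin θ * Real.sin α) * (2 * r * A) := by
      linear_combination r ^ 2 * t1 + A ^ 2 * t2
    rw [e]
    refine and_congr ?_ (and_congr ?_ ?_)
    all_goals constructor <;> intro h <;> linarith
  rcases le_or_gt α (2 * π / 3) with hα | hα
  · have hconv : ∀ x y z : ℝ, -(π / 3) ≤ x → x ≤ y → y ≤ z → z ≤ π / 3 → x ∈ Blk c r d R →
      z ∈ Blk c r d R → y ∈ Blk c r d R := by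
      intro x y z h1 h2 h3 h4 hx hz
      rw [hB] at hx hz ⊢
      exact ⟨cos_quasi h2 h3 (by linarith) (by linarith) hx.1 hz.1,
        cos_quasi h2 h3 (by linarith) (by linarith) hx.2.1 hz.2.1,
        cos_quasi h2 h3 (by linarith) (by linarith) hx.2.2 hz.2.2⟩
    by_cases hl : -(π / 3) ∈ Blk c r d R
    · left
      intro x y z h1 h2 h3 h4 hx
      refine absurd (hconv _ x _ le_rfl h1 (by linarith) le_rfl hl ?_) hx
      exact blk_refl c r hr d R hR hy _ (by positivity) le_rfl hl
    · exact Or.inr ⟨hconv, hl⟩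
  · left
    have hs : Real.sin (α + π / 3) ≤ 0 := by
      rw [← neg_nonneg, ← Real.sin_sub_pi]
      exact Real.sin_nonneg_of_nonneg_of_le_pi (by linarith) (by linarith)
    rw [Real.sin_add, Real.cos_pi_div_three, Real.sin_pi_div_three] at hs
    have hsα := Real.sin_pos_of_pos_of_lt_pi hα0 hα1
    have k1 : √3 * (A * Real.cos α) + A * Real.sin α ≤ 0 := by nlinarith
    have k2 : √3 * (A * Real.cos α) - A * Real.sin α ≤ 0 := by nlinarith
    have hB' : ∀ θ, -(π / 3) ≤ θ → θ ≤ π / 3 → (θ ∉ Blk c r d R ↔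
        -((r ^ 2 + A ^ 2 - R ^ 2) / (2 * r * A)) < Real.cos (θ - (α - π))) := by
      intro θ h1 h2
      rw [hB]
      have c1 : 0 ≤ Real.cos (θ - π / 6) :=
        Real.cos_nonneg_of_neg_pi_div_two_le_of_le (by linarith) (by linarith)
      have c2 : 0 ≤ Real.cos (θ - -(π / 6)) :=
        Real.cos_nonneg_of_neg_pi_div_two_le_of_le (by linarith) (by linarith)
      have m1 := (div_nonpos_of_nonpos_of_nonneg k1 (by positivity : 0 ≤ 2 * r)).trans c1
      have m2 := (div_nonpos_of_nonpos_of_nonneg k2 (by positivity : 0 ≤ 2 * r)).trans c2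
      rw [show θ - (α - π) = θ - α + π by ring, Real.cos_add_pi, neg_lt_neg_iff]
      rw [← not_le]
      exact not_congr ⟨fun h => h.2.2, fun h => ⟨m1, m2, h⟩⟩
    intro x y z h1 h2 h3 h4 hx hz
    rw [hB' _ (by linarith) (by linarith)] at hx hz ⊢
    exact (lt_min hx hz).trans_le (cos_quasi h2 h3 (by linarith) (by linarith)
      (min_le_left _ _) (min_le_right _ _))

/-- Two blocked sets of different type cannot meet below a common free angle. -/
lemma no_meet {L : ℝ} {P Q : Set ℝ}
    (hP : ∀ x y z : ℝ, -L ≤ x → x ≤ y → y ≤ z → z ≤ L → x ∉ P → z ∉ P → y ∉ P)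
    (hQ : ∀ x y z : ℝ, -L ≤ x → x ≤ y → y ≤ z → z ≤ L → x ∈ Q → z ∈ Q → y ∈ Q)
    (rP : ∀ t, 0 ≤ t → t ≤ L → -t ∈ P → t ∈ P)
    (rQ : ∀ t, 0 ≤ t → t ≤ L → -t ∈ Q → t ∈ Q)
    {x θ : ℝ} (hx : -L ≤ x) (hxθ : x < θ) (hθ : θ ≤ L) (xP : x ∈ P) (xQ : x ∈ Q)
    (nP : θ ∉ P) (nQ : θ ∉ Q) : False := by
  have key : -x ≤ θ := by
    by_contra h
    push Not at h
    have h0 : x < 0 := by linarith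
    exact nQ (hQ x θ (-x) hx hxθ.le h.le (by linarith) xQ
      (rQ (-x) (by linarith) (by linarith) (by simpa using xQ)))
  have h0 : 0 ≤ θ := by linarith
  exact hP (-θ) x θ (by linarith) (by linarith) hxθ.le hθ (fun h => nP (rP θ h0 hθ h)) nP xP

/-- Decomposability: for any partition `F = F₁ ∪ ⋯ ∪ F_s` of a finite
nonempty family of larger disks with centers above `c`, the intersection of the lowest
connected components of the sets `S_{F_j}` equals the lowest connected component of
`S_F`. -/
theorem decomposability {ι : Type*} [DecidableEq ι] (F : Finset ι) (hF : F.Nonempty)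
    (c : ℝ × ℝ) (r : ℝ) (hr : 0 < r)
    (ci : ι → ℝ × ℝ) (ri : ι → ℝ)
    (hri : ∀ i ∈ F, r < ri i) (hyi : ∀ i ∈ F, c.2 < (ci i).2)
    (hgp : ∀ i ∈ F, GenPos c (ci i))
    (s : ℕ) (Fs : Fin s → Finset ι)
    (hne : ∀ j, (Fs j).Nonempty)
    (hdisj : ∀ j k, j ≠ k → Disjoint (Fs j) (Fs k))
    (hcover : F = Finset.univ.biUnion Fs) :
    (⋂ j : Fin s, LC (SG c r ci ri (Fs j))) = LC (SG c r ci ri F) := by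
  have hpi := Real.pi_pos
  have mem : ∀ (G : Finset ι) (θ : ℝ), θ ∈ SG c r ci ri G ↔
      θ ∈ Set.Icc (-(π / 3)) (π / 3) ∧ ∀ i ∈ G, θ ∉ Blk c r (ci i) (ri i) := by
    intro G θ
    simp [SG, Blk]
  have hsub : ∀ j, Fs j ⊆ F := by
    intro j; rw [hcover]; exact Finset.subset_biUnion_of_mem Fs (Finset.mem_univ j)
  have hcov : ∀ i ∈ F, ∃ j, i ∈ Fs j := by
    intro i hi; rw [hcover] at hi; simpa using hi
  have hRp : ∀ i ∈ F, 0 < ri i := fun i hi => hr.trans (hri i hi)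
  have hrefl : ∀ i ∈ F, ∀ t, 0 ≤ t → t ≤ π / 3 → -t ∈ Blk c r (ci i) (ri i) →
      t ∈ Blk c r (ci i) (ri i) := fun i hi =>
    blk_refl c r hr (ci i) (ri i) (hRp i hi) (hyi i hi)
  have hdich := fun i (hi : i ∈ F) => blk_dich c r hr (ci i) (ri i) (hRp i hi) (hyi i hi)
  ext θ
  rw [Set.mem_iInter]
  constructor
  · intro h
    obtain ⟨i0, hi0⟩ := hF
    obtain ⟨j0, _⟩ := hcov i0 hi0
    refine ⟨(mem _ _).2 ⟨((mem _ _).1 (h j0).1).1, fun i hi => ?_⟩, ?_⟩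
    · obtain ⟨j, hj⟩ := hcov i hi
      exact ((mem _ _).1 (h j).1).2 i hj
    · intro θ₁ θ₂ h1 h2 h12 h2θ hn hm
      apply hn
      refine (mem _ _).2 ⟨h2, fun i hi hb => ?_⟩
      obtain ⟨j, hj⟩ := hcov i hi
      refine (h j).2 θ₁ θ₂ h1 h2 h12 h2θ (fun hh => ((mem _ _).1 hh).2 i hj hb) ?_
      exact (mem _ _).2 ⟨h1, fun i' hi' => ((mem _ _).1 hm).2 i' (hsub j hi')⟩
  · rintro ⟨hθ, hlc⟩ j
    obtain ⟨hθI, hθF⟩ := (mem _ _).1 hθ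
    refine ⟨(mem _ _).2 ⟨hθI, fun i hi => hθF i (hsub j hi)⟩, ?_⟩
    intro θ₁ θ₂ h1 h2 h12 h2θ hn hm
    obtain ⟨k, hkj, hkb⟩ : ∃ k ∈ Fs j, θ₂ ∈ Blk c r (ci k) (ri k) := by
      by_contra hcon
      push Not at hcon
      exact hn ((mem _ _).2 ⟨h2, hcon⟩)
    have hkF := hsub j hkj
    have hlt : θ₂ < θ := lt_of_le_of_ne h2θ (fun e => hθF k hkF (e ▸ hkb))
    rcases hdich k hkF with hI | ⟨hII, hlow⟩
    · exact hI θ₁ θ₂ θ h1.1 h12.le h2θ hθI.2 (((mem _ _).1 hm).2 k hkj) (hθF k hkF) hkb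
    -- the second type: the whole initial segment is covered, contradiction
    have hcovered : ∀ x ∈ Set.Icc (-(π / 3)) θ₂, ∃ i ∈ F, x ∈ Blk c r (ci i) (ri i) := by
      intro x hx
      rcases hx.2.eq_or_lt with rfl | hlt2
      · exact ⟨k, hkF, hkb⟩
      · by_contra hcon
        push Not at hcon
        have hxI : x ∈ Set.Icc (-(π / 3)) (π / 3) := ⟨hx.1, hx.2.trans h2.2⟩
        exact hlc x θ₂ hxI h2 hlt2 h2θ (fun hh => ((mem _ _).1 hh).2 k hkF hkb)
          ((mem _ _).2 ⟨hxI, hcon⟩)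
    classical
    let p : ι → Prop := fun i => ∀ x y z : ℝ, -(π / 3) ≤ x → x ≤ y → y ≤ z → z ≤ π / 3 →
      x ∉ Blk c r (ci i) (ri i) → z ∉ Blk c r (ci i) (ri i) → y ∉ Blk c r (ci i) (ri i)
    let q : ι → Prop := fun i => (∀ x y z : ℝ, -(π / 3) ≤ x → x ≤ y → y ≤ z → z ≤ π / 3 →
      x ∈ Blk c r (ci i) (ri i) → z ∈ Blk c r (ci i) (ri i) → y ∈ Blk c r (ci i) (ri i)) ∧
      -(π / 3) ∉ Blk c r (ci i) (ri i)
    let U : Set ℝ := ⋃ i ∈ F.filter p, Blk c r (ci i) (ri i)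
    let V : Set ℝ := ⋃ i ∈ F.filter q, Blk c r (ci i) (ri i)
    have hU : IsClosed U := isClosed_biUnion_finset fun i hi =>
      blk_closed _ _ _ _ (hRp i (Finset.mem_filter.1 hi).1)
    have hV : IsClosed V := isClosed_biUnion_finset fun i hi =>
      blk_closed _ _ _ _ (hRp i (Finset.mem_filter.1 hi).1)
    have hUV : Set.Icc (-(π / 3)) θ₂ ⊆ U ∪ V := by
      intro x hx
      obtain ⟨i, hi, hb⟩ := hcovered x hx
      rcases hdich i hi with h | h
      · exact Or.inl (Set.mem_biUnion (Finset.mem_filter.2 ⟨hi, h⟩) hb)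
      · exact Or.inr (Set.mem_biUnion (Finset.mem_filter.2 ⟨hi, h⟩) hb)
    have hneU : (Set.Icc (-(π / 3)) θ₂ ∩ U).Nonempty := by
      refine ⟨-(π / 3), ⟨le_rfl, h2.1⟩, ?_⟩
      obtain ⟨i, hi, hb⟩ := hcovered (-(π / 3)) ⟨le_rfl, h2.1⟩
      rcases hdich i hi with h | h
      · exact Set.mem_biUnion (Finset.mem_filter.2 ⟨hi, h⟩) hb
      · exact absurd hb h.2
    have hneV : (Set.Icc (-(π / 3)) θ₂ ∩ V).Nonempty :=
      ⟨θ₂, ⟨h2.1, le_rfl⟩, Set.mem_biUnion (Finset.mem_filter.2 ⟨hkF, hII, hlow⟩) hkb⟩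
    obtain ⟨x, hx, hxU, hxV⟩ :=
      isPreconnected_closed_iff.1 isPreconnected_Icc U V hU hV hUV hneU hneV
    obtain ⟨a, ha, hxa⟩ := Set.mem_iUnion₂.1 hxU
    obtain ⟨b, hb, hxb⟩ := Set.mem_iUnion₂.1 hxV
    obtain ⟨haF, hap⟩ := Finset.mem_filter.1 ha
    obtain ⟨hbF, hbq⟩ := Finset.mem_filter.1 hb
    exact no_meet hap hbq.1 (hrefl a haF) (hrefl b hbF) hx.1 (hx.2.trans_lt hlt) hθI.2
      hxa hxb (hθF a haF) (hθF b hbF)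
end
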